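/- arXiv:1308.0062 — 3 statements merged into one kernel-verified Lean document; each statement's English description precedes it below -/
import Mathlib

section
/- Let Ω ⊆ ℂ be open, let a : Ω → ℂ be infinitely differentiable, and let z₀ ∈ Ω. Then there exist an open neighborhood V ⊆ Ω of z₀ and an infinitely differentiable function α : V → ℂ such that ∂α/∂z = a at every point of V. -/
open MeasureTheory Complex

/-- The Wirtinger derivative `∂f/∂z = (∂f/∂x - i ∂f/∂y)/2`. -/
noncomputable def wirtingerDz (f : ℂ → ℂ) (z : ℂ) : ℂ :=
  (fderiv ℝ f z 1 - Complex.I * fderiv ℝ f z Complex.I) / 2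

open scoped ContDiff Real ComplexConjugate Convolution

lemma locallyIntegrable_inv_conj : LocallyIntegrable (fun w : ℂ => (conj w)⁻¹) := by
  refine locallyIntegrable_of_norm_le_rpow (C := 1) (α := 1) ?_ ?_ ?_ ?_
  · simp [Complex.finrank_real_complex]
  · simp [Complex.finrank_real_complex]
  · refine Filter.Eventually.of_forall fun w => ?_
    simp [Real.rpow_neg_one]
  · have : Measurable fun w : ℂ => (conj w)⁻¹ := Complex.continuous_conj.measurable.inv
    exact this.aestronglyMeasurable

lemma wirtingerDz_mul_eq (f : ℂ → ℂ) (z v : ℂ) :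
    wirtingerDz f z * v = (fderiv ℝ f z v - I * fderiv ℝ f z (I * v)) / 2 := by
  have h : ∀ u : ℂ, fderiv ℝ f z u = u.re * fderiv ℝ f z 1 + u.im * fderiv ℝ f z I := by
    intro u
    conv_lhs => rw [show u = u.re • (1 : ℂ) + u.im • I by simp]
    rw [map_add, map_smul, map_smul, real_smul, real_smul]
  rw [h v, h (I * v), wirtingerDz]
  simp only [I_mul_re, I_mul_im]
  nth_rewrite 1 [← re_add_im v]
  push_cast
  linear_combination (-(v.im : ℂ) * fderiv ℝ f z I / 2) * I_sq

lemma integrableOn_Ioi_prod_Ioo_of_continuous {E : Type*} [NormedAddCommGroup E]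
    {F : ℝ × ℝ → E} (hF : Continuous F) (R a b : ℝ) (hR : ∀ r θ, R < r → F (r, θ) = 0) :
    IntegrableOn F (Set.Ioi 0 ×ˢ Set.Ioo a b) := by
  have h : IntegrableOn F (Set.Icc 0 R ×ˢ Set.Icc a b) :=
    hF.continuousOn.integrableOn_compact (isCompact_Icc.prod isCompact_Icc)
  refine h.of_forall_sdiff_eq_zero (measurableSet_Ioi.prod measurableSet_Ioo) ?_
  rintro ⟨r, θ⟩ ⟨⟨hr, hθ⟩, hn⟩
  refine hR r θ (lt_of_not_ge fun hle => hn ⟨⟨le_of_lt hr, hle⟩, Set.Ioo_subset_Icc_self hθ⟩)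

lemma integral_fderiv_radial {h : ℂ → ℂ} (hh : ContDiff ℝ 1 h) (hc : HasCompactSupport h)
    (θ : ℝ) : ∫ r in Set.Ioi (0 : ℝ), fderiv ℝ h (r * exp (θ * I)) (exp (θ * I)) = -h 0 := by
  have hcs : HasCompactSupport fun r : ℝ => h (r * exp (θ * I)) := by
    refine hc.comp_isClosedEmbedding (g := fun r : ℝ => (r : ℂ) * exp (θ * I)) ?_
    refine Isometry.isClosedEmbedding (Isometry.of_dist_eq fun x y => ?_)
    rw [dist_eq_norm, ← sub_mul, norm_mul, norm_exp_ofReal_mul_I, mul_one, ← ofReal_sub,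
      norm_real, ← dist_eq_norm]
  have hd : ∀ r : ℝ, HasDerivAt (fun r : ℝ => h (r * exp (θ * I)))
      (fderiv ℝ h (r * exp (θ * I)) (exp (θ * I))) r := fun r => by
    have h1 : HasDerivAt (fun r : ℝ => (r : ℂ) * exp (θ * I)) (exp (θ * I)) r := by
      simpa using (Complex.ofRealCLM.hasDerivAt (x := r)).mul_const (exp (θ * I))
    exact (hh.differentiable one_ne_zero _).hasFDerivAt.comp_hasDerivAt r h1
  have := hcs.integral_Ioi_deriv_eq
    (hh.comp (Complex.ofRealCLM.contDiff.mul contDiff_const)) 0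
  simpa [Function.comp_def, fun r => (hd r).deriv] using this

lemma integral_fderiv_angular {h : ℂ → ℂ} (hh : ContDiff ℝ 1 h) {r : ℝ} (hr : r ≠ 0) :
    ∫ θ in Set.Ioo (-π) π, fderiv ℝ h (r * exp (θ * I)) (I * exp (θ * I)) = 0 := by
  have hd : ∀ θ : ℝ, HasDerivAt (fun θ : ℝ => h (r * exp (θ * I)))
      (r * fderiv ℝ h (r * exp (θ * I)) (I * exp (θ * I))) θ := fun θ => by
    have h1 : HasDerivAt (fun θ : ℝ => (r : ℂ) * exp (θ * I)) (r • (I * exp (θ * I))) θ := by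
      have h2 := (((Complex.ofRealCLM.hasDerivAt (x := θ)).mul_const I).cexp).const_mul (r : ℂ)
      simpa [mul_comm] using h2
    have h3 := (hh.differentiable one_ne_zero _).hasFDerivAt.comp_hasDerivAt θ h1
    rwa [map_smul, real_smul] at h3
  have hcd := hh.continuous_fderiv one_ne_zero
  have hcont : Continuous fun θ : ℝ =>
      (r : ℂ) * fderiv ℝ h (r * exp (θ * I)) (I * exp (θ * I)) := by fun_prop
  have key := intervalIntegral.integral_eq_sub_of_hasDerivAt (a := -π) (b := π)
    (fun θ _ => hd θ) (hcont.intervalIntegrable _ _)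
  rw [intervalIntegral.integral_const_mul,
    intervalIntegral.integral_of_le (by linarith [Real.pi_pos]), integral_Ioc_eq_integral_Ioo] at key
  simpa [neg_mul, exp_neg, exp_pi_mul_I, hr] using key

/-- `1 / (π z̄)` is a fundamental solution of `∂/∂z`. -/
lemma integral_inv_conj_mul_wirtingerDz {h : ℂ → ℂ} (hh : ContDiff ℝ 1 h)
    (hc : HasCompactSupport h) : ∫ w, (conj w)⁻¹ * wirtingerDz h w = -π * h 0 := by
  have hcd := hh.continuous_fderiv one_ne_zero
  obtain ⟨R, hR⟩ := (hc.fderiv ℝ).isCompact.isBounded.subset_closedBall 0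
  have hzero : ∀ r θ : ℝ, R < r → fderiv ℝ h (r * exp (θ * I)) = 0 := fun r θ hr => by
    refine image_eq_zero_of_notMem_tsupport fun hmem => ?_
    have := hR hmem
    rw [mem_closedBall_zero_iff, norm_mul, norm_exp_ofReal_mul_I, mul_one, norm_real] at this
    exact absurd ((le_abs_self r).trans this) (not_le.2 hr)
  have hi1 : IntegrableOn (fun p : ℝ × ℝ => fderiv ℝ h (p.1 * exp (p.2 * I)) (exp (p.2 * I)))
      (Set.Ioi 0 ×ˢ Set.Ioo (-π) π) :=
    integrableOn_Ioi_prod_Ioo_of_continuous (by fun_prop) R _ _ fun r θ hr => by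
      simp [hzero r θ hr]
  have hi2 : IntegrableOn
      (fun p : ℝ × ℝ => fderiv ℝ h (p.1 * exp (p.2 * I)) (I * exp (p.2 * I)))
      (Set.Ioi 0 ×ˢ Set.Ioo (-π) π) :=
    integrableOn_Ioi_prod_Ioo_of_continuous (by fun_prop) R _ _ fun r θ hr => by
      simp [hzero r θ hr]
  have e1 : ∫ p in Set.Ioi (0 : ℝ) ×ˢ Set.Ioo (-π) π,
      fderiv ℝ h (p.1 * exp (p.2 * I)) (exp (p.2 * I)) = -(2 * π) * h 0 := by
    rw [Measure.volume_eq_prod, ← Measure.prod_restrict, integral_prod_symm _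
      (by rwa [IntegrableOn, Measure.volume_eq_prod, ← Measure.prod_restrict] at hi1)]
    simp only [integral_fderiv_radial hh hc]
    rw [setIntegral_const, Real.volume_real_Ioo_of_le (by linarith [Real.pi_pos]), real_smul]
    push_cast
    ring
  have e2 : ∫ p in Set.Ioi (0 : ℝ) ×ˢ Set.Ioo (-π) π,
      fderiv ℝ h (p.1 * exp (p.2 * I)) (I * exp (p.2 * I)) = 0 := by
    rw [Measure.volume_eq_prod] at hi2 ⊢
    rw [setIntegral_prod _ hi2]
    exact setIntegral_eq_zero_of_forall_eq_zero fun r hr =>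
      integral_fderiv_angular hh (ne_of_gt hr)
  have hpt : ∀ p ∈ Set.Ioi (0 : ℝ) ×ˢ Set.Ioo (-π) π,
      p.1 • ((conj (Complex.polarCoord.symm p))⁻¹ * wirtingerDz h (Complex.polarCoord.symm p)) =
      (fderiv ℝ h (p.1 * exp (p.2 * I)) (exp (p.2 * I)) -
        I * fderiv ℝ h (p.1 * exp (p.2 * I)) (I * exp (p.2 * I))) / 2 := by
    rintro ⟨r, θ⟩ ⟨hr, -⟩
    have hr' : (r : ℂ) ≠ 0 := ofReal_ne_zero.2 (ne_of_gt hr)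
    have hw : Complex.polarCoord.symm (r, θ) = r * exp (θ * I) := by
      rw [Complex.polarCoord_symm_apply, exp_mul_I, ofReal_cos, ofReal_sin]
    rw [hw, ← wirtingerDz_mul_eq, real_smul, map_mul, conj_ofReal, ← exp_conj, map_mul,
      conj_ofReal, conj_I, mul_neg, exp_neg, mul_inv, inv_inv]
    field_simp
  rw [← Complex.integral_comp_polarCoord_symm, polarCoord_target,
    setIntegral_congr_fun (measurableSet_Ioi.prod measurableSet_Ioo) hpt, integral_div,
    integral_sub hi1 (hi2.const_mul I), integral_const_mul, e1, e2]
  ring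

/-- A compactly supported smooth function has a global smooth primitive for `∂/∂z`. -/
lemma exists_contDiff_wirtingerDz_eq {g : ℂ → ℂ} (hg : ContDiff ℝ ∞ g)
    (hc : HasCompactSupport g) :
    ∃ α : ℂ → ℂ, ContDiff ℝ ∞ α ∧ ∀ z, wirtingerDz α z = g z := by
  set L := ContinuousLinearMap.mul ℝ ℂ
  set k : ℂ → ℂ := fun w => (π : ℂ)⁻¹ * (conj w)⁻¹
  have hk : LocallyIntegrable k := locallyIntegrable_inv_conj.smul (π : ℂ)⁻¹
  have hg1 : ContDiff ℝ 1 g := hg.of_le (by exact_mod_cast le_top)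
  refine ⟨k ⋆[L] g, hc.contDiff_convolution_right L hk hg, fun z => ?_⟩
  have hex := (hc.fderiv ℝ).convolutionExists_right (L.precompR ℂ) hk
    (hg1.continuous_fderiv one_ne_zero) z
  have hint : ∀ v, Integrable fun t => k t * fderiv ℝ g (z - t) v := fun v =>
    (ContinuousLinearMap.apply ℝ ℂ v).integrable_comp hex
  have hfd : ∀ v, fderiv ℝ (k ⋆[L] g) z v = ∫ t, k t * fderiv ℝ g (z - t) v := fun v => by
    rw [(hc.hasFDerivAt_convolution_right L hk hg1 z).fderiv, convolution_def,
      ContinuousLinearMap.integral_apply hex]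
    rfl
  have hdiff : ∀ t, wirtingerDz (fun w => g (z - w)) t = -wirtingerDz g (z - t) := fun t => by
    have hd : HasFDerivAt (fun w => g (z - w)) (-fderiv ℝ g (z - t)) t := by
      simpa using! (hg1.differentiable one_ne_zero (z - t)).hasFDerivAt.comp t
        ((hasFDerivAt_id t).const_sub z)
    simp only [wirtingerDz, hd.fderiv, _root_.neg_apply]
    ring
  have hcs : HasCompactSupport fun w => g (z - w) :=
    hc.comp_homeomorph (Homeomorph.subLeft z)
  have hgz : ContDiff ℝ 1 fun w => g (z - w) := hg1.comp (contDiff_const.sub contDiff_id)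
  have key := integral_inv_conj_mul_wirtingerDz hgz hcs
  have hpi : (π : ℂ) ≠ 0 := ofReal_ne_zero.2 Real.pi_ne_zero
  simp only [hdiff, mul_neg, integral_neg, sub_zero, neg_mul, neg_inj] at key
  calc wirtingerDz (k ⋆[L] g) z
      = ∫ t, (π : ℂ)⁻¹ * ((conj t)⁻¹ * wirtingerDz g (z - t)) := by
        rw [wirtingerDz, hfd, hfd, ← integral_const_mul, ← integral_sub (hint 1)
          ((hint I).const_mul I), ← integral_div]
        congr 1 with t
        simp only [wirtingerDz, k]
        ring
    _ = g z := by rw [integral_const_mul, key, inv_mul_cancel_left₀ hpi]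

/-- Local solvability of `∂α/∂z = a` for smooth `a`, near any point of an open set `Ω`. -/
theorem local_solvability_dz (Ω : Set ℂ) (hΩ : IsOpen Ω) (a : ℂ → ℂ)
    (ha : ContDiffOn ℝ (⊤ : ℕ∞) a Ω) (z₀ : ℂ) (hz₀ : z₀ ∈ Ω) :
    ∃ V : Set ℂ, IsOpen V ∧ z₀ ∈ V ∧ V ⊆ Ω ∧
      ∃ α : ℂ → ℂ, ContDiffOn ℝ (⊤ : ℕ∞) α V ∧ ∀ z ∈ V, wirtingerDz α z = a z := by
  obtain ⟨ε, hε, hball⟩ := Metric.nhds_basis_closedBall.mem_iff.1 (hΩ.mem_nhds hz₀)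
  let χ : ContDiffBump z₀ := ⟨ε / 2, ε, half_pos hε, half_lt_self hε⟩
  have hsupp : tsupport χ ⊆ Ω := χ.tsupport_eq.trans_subset hball
  have hg : ContDiff ℝ ∞ fun z => χ z • a z := by
    refine contMDiff_iff_contDiff.1 <| contMDiff_of_tsupport fun z hz => ?_
    have hzΩ : z ∈ Ω := hsupp (tsupport_smul_subset_left _ _ hz)
    exact (χ.contDiffAt.smul (ha.contDiffAt (hΩ.mem_nhds hzΩ))).contMDiffAt
  obtain ⟨α, hα, hαg⟩ := exists_contDiff_wirtingerDz_eq hg χ.hasCompactSupport.smul_right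
  refine ⟨Metric.ball z₀ (ε / 2), Metric.isOpen_ball, Metric.mem_ball_self (half_pos hε),
    fun z hz => hball (Metric.ball_subset_closedBall
      (Metric.ball_subset_ball (half_le_self hε.le) hz)), α, hα.contDiffOn, fun z hz => ?_⟩
  rw [hαg, χ.one_of_mem_closedBall (Metric.ball_subset_closedBall hz), one_smul]
end

section
/- Let φ : ℝ^{2n} → ℝ be three times continuously differentiable, let Q₂ be its Taylor polynomial of degree 2 at 0, and let η : ℝ^{2n} → ℝ be a smooth function with η ≡ 1 on {ζ : |ζ| ≤ 2} and η ≡ 0 on {ζ : |ζ| ≥ 4}. For ε > 0 define φ̃(ζ) = Q₂(ζ) + η(ζ/ε)·(φ(ζ) − Q₂(ζ)). Then there exists a constant C, depending only on the supremum of ‖η‖ and its first two derivatives and on the supremum of the norm of the third derivative of φ over the closed ball {ζ : |ζ| ≤ 4ε}, such that for every ζ ∈ ℝ^{2n}, the second Fréchet derivative satisfies ‖D²φ̃(ζ) − D²φ(0)‖ ≤ C·ε. -/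
open MeasureTheory

section

variable {E : Type*} [NormedAddCommGroup E] [NormedSpace ℝ E]

/-- The Taylor polynomial of degree two at the origin. -/
noncomputable def quadraticTaylor (φ : E → ℝ) (x : E) : ℝ :=
  φ 0 + iteratedFDeriv ℝ 1 φ 0 ![x] + (1 / 2) * iteratedFDeriv ℝ 2 φ 0 ![x, x]

lemma quadraticTaylor_eq (φ : E → ℝ) :
    quadraticTaylor φ =
      fun x => φ 0 + fderiv ℝ φ 0 x + (1 / 2) * fderiv ℝ (fderiv ℝ φ) 0 x x := by
  ext x
  simp [quadraticTaylor, iteratedFDeriv_two_apply]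

lemma contDiff_quadraticTaylor (φ : E → ℝ) {m : WithTop ℕ∞} :
    ContDiff ℝ m (quadraticTaylor φ) := by
  rw [quadraticTaylor_eq]
  fun_prop

lemma fderiv_quadraticTaylor {φ : E → ℝ} (hφ : ContDiff ℝ 2 φ) (x : E) :
    fderiv ℝ (quadraticTaylor φ) x = fderiv ℝ φ 0 + fderiv ℝ (fderiv ℝ φ) 0 x := by
  have hsymm : IsSymmSndFDerivAt ℝ φ 0 := hφ.contDiffAt.isSymmSndFDerivAt (by simp)
  rw [quadraticTaylor_eq]
  set L := fderiv ℝ φ 0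
  set B := fderiv ℝ (fderiv ℝ φ) 0
  have hB : HasFDerivAt (fun y => B y y) _ x := B.hasFDerivAt.clm_apply (hasFDerivAt_id x)
  have h := ((L.hasFDerivAt (x := x)).const_add (φ 0)).add (hB.const_mul (1 / 2))
  refine h.fderiv.trans ?_
  ext v
  have : B v x = B x v := hsymm v x
  simp [this]
  ring

lemma iteratedFDeriv_two_quadraticTaylor {φ : E → ℝ} (hφ : ContDiff ℝ 2 φ) (x : E) :
    iteratedFDeriv ℝ 2 (quadraticTaylor φ) x = iteratedFDeriv ℝ 2 φ 0 := by
  ext m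
  rw [iteratedFDeriv_two_apply, iteratedFDeriv_two_apply,
    funext (fderiv_quadraticTaylor hφ)]
  simp

/-- A derivative vanishing at the origin is controlled on a ball by the next derivative. -/
lemma norm_iteratedFDeriv_le_of_eq_zero {f : E → ℝ} {k : ℕ} (hf : ContDiff ℝ (k + 1) f)
    (h0 : iteratedFDeriv ℝ k f 0 = 0) {r M : ℝ} (hr : 0 ≤ r)
    (hM : ∀ x, ‖x‖ ≤ r → ‖iteratedFDeriv ℝ (k + 1) f x‖ ≤ M) {x : E} (hx : ‖x‖ ≤ r) :
    ‖iteratedFDeriv ℝ k f x‖ ≤ M * r := by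
  have hd : Differentiable ℝ (iteratedFDeriv ℝ k f) :=
    hf.differentiable_iteratedFDeriv (by exact_mod_cast Nat.lt_succ_self k)
  have h := (convex_closedBall (0 : E) r).norm_image_sub_le_of_norm_fderiv_le
    (𝕜 := ℝ) (f := iteratedFDeriv ℝ k f) (C := M) (fun y _ => hd y)
    (fun y hy => by
      rw [norm_fderiv_iteratedFDeriv]
      exact hM y (by simpa using hy))
    (Metric.mem_closedBall_self hr) (by simpa using hx : x ∈ Metric.closedBall (0 : E) r)
  rw [h0, sub_zero, sub_zero] at h
  have hM0 : 0 ≤ M := (norm_nonneg _).trans (hM 0 (by simpa using hr))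
  exact h.trans (by gcongr)

/-- Taylor estimates for the remainder of order three and its first two derivatives. -/
lemma norm_iteratedFDeriv_sub_quadraticTaylor_le {φ : E → ℝ} (hφ : ContDiff ℝ 3 φ)
    {r K : ℝ} (hr : 0 ≤ r) (hK : ∀ x, ‖x‖ ≤ r → ‖iteratedFDeriv ℝ 3 φ x‖ ≤ K)
    {x : E} (hx : ‖x‖ ≤ r) :
    ‖iteratedFDeriv ℝ 2 (φ - quadraticTaylor φ) x‖ ≤ K * r ∧
      ‖iteratedFDeriv ℝ 1 (φ - quadraticTaylor φ) x‖ ≤ K * r * r ∧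
      ‖iteratedFDeriv ℝ 0 (φ - quadraticTaylor φ) x‖ ≤ K * r * r * r := by
  have hφ2 : ContDiff ℝ 2 φ := hφ.of_le (by norm_num)
  have hR : ContDiff ℝ 3 (φ - quadraticTaylor φ) := hφ.sub (contDiff_quadraticTaylor φ)
  have h2 : iteratedFDeriv ℝ 2 (φ - quadraticTaylor φ) =
      fun y => iteratedFDeriv ℝ 2 φ y - iteratedFDeriv ℝ 2 φ 0 := by
    ext1 y
    rw [iteratedFDeriv_sub_apply hφ2.contDiffAt (contDiff_quadraticTaylor φ).contDiffAt,
      iteratedFDeriv_two_quadraticTaylor hφ2]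
  have h3 : ∀ y, ‖iteratedFDeriv ℝ 3 (φ - quadraticTaylor φ) y‖ =
      ‖iteratedFDeriv ℝ 3 φ y‖ := fun y => by
    rw [← norm_fderiv_iteratedFDeriv, ← norm_fderiv_iteratedFDeriv, h2, fderiv_sub_const]
  have b2 : ∀ y, ‖y‖ ≤ r → ‖iteratedFDeriv ℝ 2 (φ - quadraticTaylor φ) y‖ ≤ K * r :=
    fun y hy => norm_iteratedFDeriv_le_of_eq_zero (hR.of_le (by norm_num)) (by simp [h2]) hr
      (fun z hz => (h3 z).trans_le (hK z hz)) hy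
  have b1 : ∀ y, ‖y‖ ≤ r → ‖iteratedFDeriv ℝ 1 (φ - quadraticTaylor φ) y‖ ≤ K * r * r := by
    refine fun y hy =>
      norm_iteratedFDeriv_le_of_eq_zero (hR.of_le (by norm_num)) ?_ hr b2 hy
    ext m
    rw [iteratedFDeriv_one_apply, fderiv_sub (hφ.differentiable (by norm_num) 0)
      ((contDiff_quadraticTaylor (m := 1) φ).differentiable (by norm_num) 0),
      fderiv_quadraticTaylor hφ2]
    simp
  refine ⟨b2 x hx, b1 x hx, ?_⟩
  refine norm_iteratedFDeriv_le_of_eq_zero (hR.of_le (by norm_num)) ?_ hr b1 hx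
  ext m
  simp [quadraticTaylor_eq]

end

/-- Gluing a weight to its quadratic Taylor polynomial at scale `ε` changes the Hessian
from the Hessian at the origin by at most `O(ε)`, uniformly. -/
theorem glued_weight_hessian_bound (Kη K₃ : ℝ) :
    ∃ C : ℝ, ∀ (n : ℕ) (φ η : EuclideanSpace ℝ (Fin (2 * n)) → ℝ) (ε : ℝ), 0 < ε →
      ContDiff ℝ 3 φ → ContDiff ℝ (⊤ : ℕ∞) η →
      (∀ ζ, ‖ζ‖ ≤ 2 → η ζ = 1) → (∀ ζ, 4 ≤ ‖ζ‖ → η ζ = 0) →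
      (∀ ζ, |η ζ| ≤ Kη) →
      (∀ ζ, ‖iteratedFDeriv ℝ 1 η ζ‖ ≤ Kη) →
      (∀ ζ, ‖iteratedFDeriv ℝ 2 η ζ‖ ≤ Kη) →
      (∀ ζ, ‖ζ‖ ≤ 4 * ε → ‖iteratedFDeriv ℝ 3 φ ζ‖ ≤ K₃) →
      ∀ ζ, ‖iteratedFDeriv ℝ 2
          (fun x =>
            (φ 0 + iteratedFDeriv ℝ 1 φ 0 ![x] + (1 / 2) * iteratedFDeriv ℝ 2 φ 0 ![x, x]) +
              η (ε⁻¹ • x) *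
                (φ x -
                  (φ 0 + iteratedFDeriv ℝ 1 φ 0 ![x] +
                    (1 / 2) * iteratedFDeriv ℝ 2 φ 0 ![x, x]))) ζ
          - iteratedFDeriv ℝ 2 φ 0‖ ≤ C * ε := by
  refine ⟨100 * (Kη * K₃), ?_⟩
  intro n φ η ε hε hφ hη _ hη0 hK0 hK1 hK2 hK3 ζ
  have hφ2 : ContDiff ℝ 2 φ := hφ.of_le (by norm_num)
  have hη2 : ContDiff ℝ 2 η := contDiff_infty.1 hη 2
  have hKη : 0 ≤ Kη := (abs_nonneg _).trans (hK0 0)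
  have hK₃ : 0 ≤ K₃ := (norm_nonneg _).trans (hK3 0 (by simpa using hε.le))
  have hR : ContDiff ℝ 2 (φ - quadraticTaylor φ) := hφ2.sub (contDiff_quadraticTaylor φ)
  have hηε : ContDiff ℝ 2 (fun x => η (ε⁻¹ • x)) := by fun_prop
  have hprod : ContDiff ℝ 2 (fun x => η (ε⁻¹ • x) * (φ - quadraticTaylor φ) x) := hηε.mul hR
  change ‖iteratedFDeriv ℝ 2 (quadraticTaylor φ +
    fun x => η (ε⁻¹ • x) * (φ - quadraticTaylor φ) x) ζ - iteratedFDeriv ℝ 2 φ 0‖ ≤ _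
  rw [iteratedFDeriv_add_apply (contDiff_quadraticTaylor φ).contDiffAt hprod.contDiffAt,
    iteratedFDeriv_two_quadraticTaylor hφ2, add_sub_cancel_left]
  rcases le_or_gt ‖ζ‖ (4 * ε) with hζ | hζ
  · obtain ⟨b2, b1, b0⟩ :=
      norm_iteratedFDeriv_sub_quadraticTaylor_le hφ (by positivity) hK3 hζ
    have hscale : ∀ i : ℕ, i ≤ 2 → ‖iteratedFDeriv ℝ i η (ε⁻¹ • ζ)‖ ≤ Kη →
        ‖iteratedFDeriv ℝ i (fun x => η (ε⁻¹ • x)) ζ‖ ≤ ε⁻¹ ^ i * Kη := fun i hi h => by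
      rw [iteratedFDeriv_comp_const_smul ε⁻¹ (hη2.of_le (by exact_mod_cast hi)), norm_smul,
        norm_pow, Real.norm_of_nonneg (inv_nonneg.2 hε.le)]
      gcongr
    have s0 := hscale 0 (by norm_num) (by simpa using hK0 (ε⁻¹ • ζ))
    have s1 := hscale 1 (by norm_num) (hK1 _)
    have s2 := hscale 2 (by norm_num) (hK2 _)
    refine (norm_iteratedFDeriv_mul_le hηε hR ζ (n := 2) le_rfl).trans ?_
    simp only [Finset.sum_range_succ, Finset.sum_range_zero]
    calc _ ≤ 0 + ((Nat.choose 2 0 : ℕ) : ℝ) * (ε⁻¹ ^ 0 * Kη) * (K₃ * (4 * ε))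
          + ((Nat.choose 2 1 : ℕ) : ℝ) * (ε⁻¹ ^ 1 * Kη) * (K₃ * (4 * ε) * (4 * ε))
          + ((Nat.choose 2 2 : ℕ) : ℝ) * (ε⁻¹ ^ 2 * Kη) *
            (K₃ * (4 * ε) * (4 * ε) * (4 * ε)) := by
          gcongr
      _ = 100 * (Kη * K₃) * ε := by
          norm_num [Nat.choose]
          field_simp
          ring
  · have hev : (fun x => η (ε⁻¹ • x) * (φ - quadraticTaylor φ) x) =ᶠ[nhds ζ] fun _ => 0 := by
      filter_upwards [continuous_norm.continuousAt.eventually_const_lt hζ] with x hx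
      rw [hη0 (ε⁻¹ • x), zero_mul]
      rw [norm_smul, norm_inv, Real.norm_of_nonneg hε.le, ← div_eq_inv_mul, le_div_iff₀ hε]
      exact hx.le
    rw [(hev.iteratedFDeriv ℝ 2).eq_of_nhds]
    simp only [iteratedFDeriv_fun_zero, Pi.zero_apply, norm_zero]
    positivity
end

section
/- Let U and U′ be bounded open subsets of ℂ with the closure of U contained in U′, and let φ : ℂ → ℝ be infinitely differentiable with ∂²φ/∂z∂z̄ ≥ a at every point, for some constant a > 0. Then there exist constants C < ∞, c > 0 and Λ < ∞ such that for every λ ≥ Λ and every continuously differentiable function u : ℂ → ℂ, (∫_U |u|² dm)^{1/2} ≤ C (∫_{U′} |−∂u/∂z + λ(∂φ/∂z)·u|² dm)^{1/2} + C e^{−cλ} (∫_{U′} |u|² dm)^{1/2}. -/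
open MeasureTheory Complex

/-- `∂φ/∂z` for a real-valued `φ`. -/
noncomputable def wirtingerDzR (φ : ℂ → ℝ) (z : ℂ) : ℂ :=
  ((fderiv ℝ φ z 1 : ℝ) - Complex.I * (fderiv ℝ φ z Complex.I : ℝ)) / 2

/-- The Laplacian `Δφ = φ_xx + φ_yy`; `∂²φ/∂z∂z̄ = Δφ/4`. -/
noncomputable def lapl (φ : ℂ → ℝ) (z : ℂ) : ℝ :=
  fderiv ℝ (fun w => fderiv ℝ φ w 1) z 1 +
    fderiv ℝ (fun w => fderiv ℝ φ w Complex.I) z Complex.I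

open Filter Topology Set in
/-- Smooth Urysohn lemma for a compact subset of an open set. -/
theorem exists_contDiff_bump_of_isCompact_subset {K W : Set ℂ} (hK : IsCompact K) (hW : IsOpen W)
    (hKW : K ⊆ W) :
    ∃ f : ℂ → ℝ, ContDiff ℝ (⊤ : ℕ∞) f ∧ HasCompactSupport f ∧ tsupport f ⊆ W ∧
      (∀ z, f z ∈ Icc (0 : ℝ) 1) ∧ ∀ z ∈ K, f z = 1 := by
  obtain ⟨L, hL, hKL, hLW⟩ := exists_compact_between hK hW hKW
  obtain ⟨f, hf, hrange, h0, h1⟩ := exists_contMDiff_zero_iff_one_iff_of_isClosed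
    (modelWithCornersSelf ℝ ℂ) (n := (⊤ : ℕ∞)) (isOpen_interior (s := L)).isClosed_compl
    hK.isClosed (disjoint_compl_left_iff_subset.2 hKL)
  have hsupp : Function.support f ⊆ L := fun z hz => by
    by_contra hzL
    exact hz ((h0 z).1 fun h => hzL (interior_subset h))
  have htsupp : tsupport f ⊆ L := closure_minimal hsupp hL.isClosed
  exact ⟨f, hf.contDiff, hL.of_isClosed_subset (isClosed_tsupport f) htsupp, htsupp.trans hLW,
    fun z => hrange (mem_range_self z), fun z hz => (h1 z).1 hz⟩

section NullLagrangian

variable {E : Type*} [NormedAddCommGroup E] [NormedSpace ℝ E] [MeasurableSpace E]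
  [BorelSpace E] {μ : Measure E} [μ.IsAddHaarMeasure]

theorem hasDerivAt_integral_mul_translate {h g : E → ℝ} (hh : Continuous h)
    (hhs : HasCompactSupport h) (hg : ContDiff ℝ 1 g) (hgs : HasCompactSupport g) (b : E) :
    HasDerivAt (fun t : ℝ => ∫ z, h z * g (z + t • b) ∂μ) (∫ z, h z * fderiv ℝ g z b ∂μ) 0 := by
  have hg'c : Continuous fun z => fderiv ℝ g z b :=
    (hg.continuous_fderiv one_ne_zero).clm_apply continuous_const
  obtain ⟨C, hC⟩ := hg'c.bounded_above_of_compact_support (hgs.fderiv_apply ℝ b)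
  have key := (hasDerivAt_integral_of_dominated_loc_of_deriv_le (μ := μ) (x₀ := (0 : ℝ))
    (F := fun t z => h z * g (z + t • b)) (F' := fun t z => h z * fderiv ℝ g (z + t • b) b)
    (bound := fun z => ‖h z‖ * C) Filter.univ_mem
    (Filter.Eventually.of_forall fun t => Continuous.aestronglyMeasurable
      (hh.mul (hg.continuous.comp (by fun_prop))))
    (Continuous.integrable_of_hasCompactSupport
      (hh.mul (hg.continuous.comp (by fun_prop))) hhs.mul_right)
    (Continuous.aestronglyMeasurable (hh.mul (hg'c.comp (by fun_prop))))
    (Filter.Eventually.of_forall fun z t _ => ?_)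
    ((hh.integrable_of_hasCompactSupport hhs).norm.mul_const C)
    (Filter.Eventually.of_forall fun z t _ => ?_)).2
  · simpa using key
  · rw [norm_mul]
    exact mul_le_mul_of_nonneg_left (hC _) (norm_nonneg _)
  · have h1 : HasDerivAt (fun t : ℝ => z + t • b) b t := by
      simpa using ((hasDerivAt_id t).smul_const b).const_add z
    have h2 := (hg.differentiable one_ne_zero (z + t • b)).hasFDerivAt.comp_hasDerivAt t h1
    exact h2.const_mul (h z)

variable [FiniteDimensional ℝ E]

/-- Integration by parts for a continuously differentiable pair, one of compact support. -/
theorem integral_mul_fderiv_of_hasCompactSupport {f g : E → ℝ} (hf : ContDiff ℝ 1 f)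
    (hg : ContDiff ℝ 1 g) (hfs : HasCompactSupport f) (v : E) :
    ∫ z, f z * fderiv ℝ g z v ∂μ = -∫ z, fderiv ℝ f z v * g z ∂μ := by
  have hf' : Continuous fun z => fderiv ℝ f z v :=
    (hf.continuous_fderiv one_ne_zero).clm_apply continuous_const
  have hg' : Continuous fun z => fderiv ℝ g z v :=
    (hg.continuous_fderiv one_ne_zero).clm_apply continuous_const
  exact integral_mul_fderiv_eq_neg_fderiv_mul_of_integrable
    ((hf'.mul hg.continuous).integrable_of_hasCompactSupport (hfs.fderiv_apply ℝ v).mul_right)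
    ((hf.continuous.mul hg').integrable_of_hasCompactSupport hfs.mul_right)
    ((hf.continuous.mul hg.continuous).integrable_of_hasCompactSupport hfs.mul_right)
    (fun z _ => hf.differentiable one_ne_zero z) (fun z _ => hg.differentiable one_ne_zero z)

/-- The Jacobian determinant of a compactly supported `C¹` map is a null Lagrangian. -/
theorem integral_fderiv_mul_fderiv_comm {f g : E → ℝ} (hf : ContDiff ℝ 1 f)
    (hg : ContDiff ℝ 1 g) (hfs : HasCompactSupport f) (hgs : HasCompactSupport g) (a b : E) :
    ∫ z, fderiv ℝ f z a * fderiv ℝ g z b ∂μ = ∫ z, fderiv ℝ f z b * fderiv ℝ g z a ∂μ := by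
  have hf' : Continuous fun z => fderiv ℝ f z a :=
    (hf.continuous_fderiv one_ne_zero).clm_apply continuous_const
  have hg' : Continuous fun z => fderiv ℝ g z a :=
    (hg.continuous_fderiv one_ne_zero).clm_apply continuous_const
  have h1 := hasDerivAt_integral_mul_translate (μ := μ) hf' (hfs.fderiv_apply ℝ a) hg hgs b
  have h2 := (hasDerivAt_integral_mul_translate (μ := μ) hg' (hgs.fderiv_apply ℝ a) hf hfs
    (-b)).neg
  have heq : (fun t : ℝ => ∫ z, fderiv ℝ f z a * g (z + t • b) ∂μ) =
      -fun t : ℝ => ∫ z, fderiv ℝ g z a * f (z + t • -b) ∂μ := by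
    funext t
    have hgt : ContDiff ℝ 1 fun z => g (z + t • b) := hg.comp (by fun_prop)
    have hibp := integral_mul_fderiv_of_hasCompactSupport (μ := μ) hf hgt hfs a
    have hshift := integral_add_right_eq_self (μ := μ)
      (fun z => fderiv ℝ g z a * f (z + t • -b)) (t • b)
    simp only [fderiv_comp_add_right, smul_neg, add_neg_cancel_right] at hibp hshift
    simp only [Pi.neg_apply, smul_neg]
    rw [← hshift, eq_comm, neg_eq_iff_eq_neg, ← hibp]
    simp only [mul_comm]
  rw [heq] at h1
  rw [h1.unique h2]
  simp only [map_neg, mul_neg, integral_neg, neg_neg, mul_comm]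

end NullLagrangian

theorem normSq_adjoint_pointwise (A B v : ℂ) (P Q : ℝ) :
    (A.re * B.im - B.re * A.im) -
        (1 / 2) * (P * (2 * (v.re * A.re + v.im * A.im)) +
          Q * (2 * (v.re * B.re + v.im * B.im))) ≤
      ‖-((A - I * B) / 2) + (P - I * Q) / 2 * v‖ ^ 2 := by
  have h := sq_nonneg ‖(A + I * B) / 2 + (P + I * Q) / 2 * v‖
  rw [← normSq_eq_norm_sq, normSq_apply] at h ⊢
  simp at h ⊢
  linarith

/-- The basic `L²` estimate for the twisted adjoint Cauchy–Riemann operator. -/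
theorem integral_lapl_mul_norm_sq_le {Ψ : ℂ → ℝ} (hΨ : ContDiff ℝ 2 Ψ) {v : ℂ → ℂ}
    (hv : ContDiff ℝ 1 v) (hvs : HasCompactSupport v) :
    (1 / 2) * ∫ z, lapl Ψ z * ‖v z‖ ^ 2 ≤
      ∫ z, ‖-wirtingerDz v z + wirtingerDzR Ψ z * v z‖ ^ 2 := by
  have hf : ContDiff ℝ 1 fun z => (v z).re := reCLM.contDiff.comp hv
  have hg : ContDiff ℝ 1 fun z => (v z).im := imCLM.contDiff.comp hv
  have hfs : HasCompactSupport fun z => (v z).re := hvs.comp_left (g := Complex.re) rfl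
  have hgs : HasCompactSupport fun z => (v z).im := hvs.comp_left (g := Complex.im) rfl
  have hvd := hv.differentiable one_ne_zero
  have hfd (z w : ℂ) : fderiv ℝ (fun z => (v z).re) z w = (fderiv ℝ v z w).re := by
    have := (reCLM.hasFDerivAt.comp z (hvd z).hasFDerivAt).fderiv
    exact congrArg (fun T : ℂ →L[ℝ] ℝ => T w) this
  have hgd (z w : ℂ) : fderiv ℝ (fun z => (v z).im) z w = (fderiv ℝ v z w).im := by
    have := (imCLM.hasFDerivAt.comp z (hvd z).hasFDerivAt).fderiv
    exact congrArg (fun T : ℂ →L[ℝ] ℝ => T w) this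
  have hN : ContDiff ℝ 1 fun z => ‖v z‖ ^ 2 := hv.norm_sq ℝ
  have hNs : HasCompactSupport fun z => ‖v z‖ ^ 2 :=
    hvs.comp_left (g := fun w : ℂ => ‖w‖ ^ 2) (by simp)
  have hNd (z w : ℂ) : fderiv ℝ (fun z => ‖v z‖ ^ 2) z w =
      2 * ((v z).re * (fderiv ℝ v z w).re + (v z).im * (fderiv ℝ v z w).im) := by
    have h1 : (fun z => ‖v z‖ ^ 2) = fun z => (v z).re * (v z).re + (v z).im * (v z).im := by
      funext z; rw [← normSq_eq_norm_sq, normSq_apply]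
    have h2 := hf.differentiable one_ne_zero z
    have h3 := hg.differentiable one_ne_zero z
    rw [h1, fderiv_fun_add (h2.fun_mul h2) (h3.fun_mul h3), fderiv_fun_mul h2 h2,
      fderiv_fun_mul h3 h3]
    simp [hfd, hgd]
    ring
  have hΨ' (w : ℂ) : ContDiff ℝ 1 fun z => fderiv ℝ Ψ z w :=
    (hΨ.fderiv_right (m := 1) (by norm_num)).clm_apply contDiff_const
  have hc (w : ℂ) : Continuous fun z => fderiv ℝ v z w :=
    (hv.continuous_fderiv one_ne_zero).clm_apply continuous_const
  have hfc (w : ℂ) : Continuous fun z => fderiv ℝ (fun z => (v z).re) z w :=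
    (hf.continuous_fderiv one_ne_zero).clm_apply continuous_const
  have hgc (w : ℂ) : Continuous fun z => fderiv ℝ (fun z => (v z).im) z w :=
    (hg.continuous_fderiv one_ne_zero).clm_apply continuous_const
  have hNc (w : ℂ) : Continuous fun z => fderiv ℝ (fun z => ‖v z‖ ^ 2) z w :=
    (hN.continuous_fderiv one_ne_zero).clm_apply continuous_const
  have hΨc (w : ℂ) : Continuous fun z => fderiv ℝ (fun z => fderiv ℝ Ψ z w) z w :=
    ((hΨ' w).continuous_fderiv one_ne_zero).clm_apply continuous_const
  have iJ (w w' : ℂ) : Integrable fun z =>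
      fderiv ℝ (fun z => (v z).re) z w * fderiv ℝ (fun z => (v z).im) z w' :=
    ((hfc w).mul (hgc w')).integrable_of_hasCompactSupport (hfs.fderiv_apply ℝ w).mul_right
  have iP (w : ℂ) : Integrable fun z => fderiv ℝ Ψ z w * fderiv ℝ (fun z => ‖v z‖ ^ 2) z w :=
    ((hΨ' w).continuous.mul (hNc w)).integrable_of_hasCompactSupport
      (hNs.fderiv_apply ℝ w).mul_left
  have iL (w : ℂ) : Integrable fun z => fderiv ℝ (fun z => fderiv ℝ Ψ z w) z w * ‖v z‖ ^ 2 :=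
    ((hΨc w).mul hN.continuous).integrable_of_hasCompactSupport hNs.mul_left
  have ibp (w : ℂ) : ∫ z, fderiv ℝ Ψ z w * fderiv ℝ (fun z => ‖v z‖ ^ 2) z w =
      -∫ z, fderiv ℝ (fun z => fderiv ℝ Ψ z w) z w * ‖v z‖ ^ 2 := by
    have := integral_mul_fderiv_of_hasCompactSupport (μ := volume) hN (hΨ' w) hNs w
    simp only [mul_comm] at this ⊢
    rw [this, neg_neg]
  have hJ := integral_fderiv_mul_fderiv_comm (μ := volume) hf hg hfs hgs 1 I
  have hWc : Continuous fun z => -wirtingerDz v z + wirtingerDzR Ψ z * v z := by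
    unfold wirtingerDz wirtingerDzR
    have h1 := hc 1
    have h2 := hc I
    have h3 := (hΨ' 1).continuous
    have h4 := (hΨ' I).continuous
    have h5 := hv.continuous
    fun_prop
  have hWs : HasCompactSupport fun z => -wirtingerDz v z + wirtingerDzR Ψ z * v z := by
    refine HasCompactSupport.intro (K := tsupport v) hvs ?_
    intro z hz
    have h0 : fderiv ℝ v z = 0 := image_eq_zero_of_notMem_tsupport
      fun h => hz (tsupport_fderiv_subset ℝ h)
    simp [wirtingerDz, h0, image_eq_zero_of_notMem_tsupport hz]
  have hW2c : Continuous fun z => ‖-wirtingerDz v z + wirtingerDzR Ψ z * v z‖ ^ 2 :=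
    hWc.norm.pow 2
  have hW2s : HasCompactSupport fun z => ‖-wirtingerDz v z + wirtingerDzR Ψ z * v z‖ ^ 2 :=
    hWs.comp_left (g := fun w : ℂ => ‖w‖ ^ 2) (by simp)
  have iW := hW2c.integrable_of_hasCompactSupport (μ := volume) hW2s
  have hmono := integral_mono
    (((iJ 1 I).sub (iJ I 1)).sub (((iP 1).add (iP I)).const_mul (1 / 2))) iW fun z => by
      have := normSq_adjoint_pointwise (fderiv ℝ v z 1) (fderiv ℝ v z I) (v z)
        (fderiv ℝ Ψ z 1) (fderiv ℝ Ψ z I)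
      simpa only [Pi.sub_apply, Pi.add_apply, hfd, hgd, hNd, wirtingerDz, wirtingerDzR] using this
  have hlapl : ∫ z, lapl Ψ z * ‖v z‖ ^ 2 =
      (∫ z, fderiv ℝ (fun z => fderiv ℝ Ψ z 1) z 1 * ‖v z‖ ^ 2) +
        ∫ z, fderiv ℝ (fun z => fderiv ℝ Ψ z I) z I * ‖v z‖ ^ 2 := by
    rw [← integral_add (iL 1) (iL I)]
    simp only [lapl, add_mul]
  rw [integral_sub' ((iJ 1 I).sub (iJ I 1)) (((iP 1).add (iP I)).const_mul (1 / 2)),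
    integral_sub' (iJ 1 I) (iJ I 1), integral_const_mul, integral_add' (iP 1) (iP I),
    ibp, ibp, hJ] at hmono
  linarith

theorem lapl_const_mul_add_const_mul {φ η : ℂ → ℝ} (hφ : ContDiff ℝ 2 φ) (hη : ContDiff ℝ 2 η)
    (s t : ℝ) (z : ℂ) :
    lapl (fun z => s * (φ z + t * η z)) z = s * (lapl φ z + t * lapl η z) := by
  have general {f g : ℂ → ℝ} (hf : Differentiable ℝ f) (hg : Differentiable ℝ g) (z w : ℂ) :
      fderiv ℝ (fun z => s * (f z + t * g z)) z w =
        s * (fderiv ℝ f z w + t * fderiv ℝ g z w) := by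
    rw [(((hf z).hasFDerivAt.fun_add ((hg z).hasFDerivAt.const_mul t)).const_mul s).fderiv]
    simp
    ring
  have hd {f : ℂ → ℝ} (hf : ContDiff ℝ 2 f) (w : ℂ) : Differentiable ℝ fun z => fderiv ℝ f z w :=
    ((hf.fderiv_right (m := 1) (by norm_num)).clm_apply contDiff_const).differentiable one_ne_zero
  have hφd := hφ.differentiable two_ne_zero
  have hηd := hη.differentiable two_ne_zero
  simp only [lapl, general hφd hηd, general (hd hφ _) (hd hη _)]
  ring

/-- Conjugation of the twisted adjoint operator by an exponential weight and a cutoff. -/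
theorem adjoint_cutoff_mul_exp {φ η χ : ℂ → ℝ} {u : ℂ → ℂ} (hφ : Differentiable ℝ φ)
    (hη : Differentiable ℝ η) (hχ : Differentiable ℝ χ) (hu : Differentiable ℝ u) (s t : ℝ)
    (z : ℂ) :
    -wirtingerDz (fun z => (χ z * Real.exp (s * (t * η z))) • u z) z +
        wirtingerDzR (fun z => s * (φ z + t * η z)) z *
          ((χ z * Real.exp (s * (t * η z))) • u z) =
      Real.exp (s * (t * η z)) *
        (χ z * (-wirtingerDz u z + s * wirtingerDzR φ z * u z) - wirtingerDzR χ z * u z) := by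
  have h1 := ((hχ z).hasFDerivAt.fun_mul
    ((((hη z).hasFDerivAt.const_mul t).const_mul s).exp)).fun_smul (hu z).hasFDerivAt
  have h2 := ((hφ z).hasFDerivAt.fun_add ((hη z).hasFDerivAt.const_mul t)).const_mul s
  simp only [wirtingerDz, wirtingerDzR]
  rw [h1.fderiv, h2.fderiv]
  simp
  ring

theorem norm_wirtingerDzR_le (φ : ℂ → ℝ) (z : ℂ) : ‖wirtingerDzR φ z‖ ≤ ‖fderiv ℝ φ z‖ := by
  have h1 : ‖fderiv ℝ φ z 1‖ ≤ ‖fderiv ℝ φ z‖ := by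
    simpa using (fderiv ℝ φ z).le_opNorm 1
  have h2 : ‖fderiv ℝ φ z I‖ ≤ ‖fderiv ℝ φ z‖ := by
    simpa using (fderiv ℝ φ z).le_opNorm I
  rw [wirtingerDzR, norm_div, Complex.norm_ofNat]
  have h3 := norm_sub_le ((fderiv ℝ φ z 1 : ℝ) : ℂ) (I * (fderiv ℝ φ z I : ℝ))
  rw [norm_mul, norm_I, one_mul, norm_real, norm_real] at h3
  linarith

/-- The weighted estimate behind exponential localization: `η` is the weight, which vanishes
wherever the cutoff `χ` is not locally constant. -/
theorem integral_norm_sq_weighted_le {U U' : Set ℂ} (hU : MeasurableSet U)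
    (hU' : MeasurableSet U') (hU'bdd : Bornology.IsBounded U') {φ η χ : ℂ → ℝ}
    (hφ : ContDiff ℝ 2 φ) (hη : ContDiff ℝ 2 η) (hχ : ContDiff ℝ 1 χ)
    (hχs : HasCompactSupport χ) (hχU' : tsupport χ ⊆ U')
    (hη1 : ∀ z, η z ≤ 1) (hχ1 : ∀ z, |χ z| ≤ 1)
    (hηU : ∀ z ∈ U, η z = 1) (hχU : ∀ z ∈ U, χ z = 1)
    (hχη : ∀ z, η z ≠ 0 → fderiv ℝ χ z = 0) {M : ℝ} (hM : ∀ z, ‖fderiv ℝ χ z‖ ≤ M)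
    {a t s : ℝ} (ha : 0 ≤ a) (ht : 0 ≤ t) (hs : 0 ≤ s)
    (hl : ∀ z, 2 * a ≤ lapl φ z + t * lapl η z) {u : ℂ → ℂ} (hu : ContDiff ℝ 1 u) :
    s * a * Real.exp (s * t) ^ 2 * ∫ z in U, ‖u z‖ ^ 2 ≤
      2 * Real.exp (s * t) ^ 2 *
          (∫ z in U', ‖-wirtingerDz u z + (s : ℂ) * wirtingerDzR φ z * u z‖ ^ 2) +
        2 * M ^ 2 * ∫ z in U', ‖u z‖ ^ 2 := by
  set Ψ : ℂ → ℝ := fun z => s * (φ z + t * η z) with hΨdef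
  set v : ℂ → ℂ := fun z => (χ z * Real.exp (s * (t * η z))) • u z with hvdef
  have hη' : ContDiff ℝ 1 η := hη.of_le (by norm_num)
  have hΨ : ContDiff ℝ 2 Ψ := contDiff_const.mul (hφ.add (contDiff_const.mul hη))
  have hv : ContDiff ℝ 1 v :=
    (hχ.mul (contDiff_const.mul (contDiff_const.mul hη')).exp).smul hu
  have hvs : HasCompactSupport v := (hχs.mul_right (f' := fun z =>
    Real.exp (s * (t * η z)))).smul_right (f' := u)
  have hbasic := integral_lapl_mul_norm_sq_le hΨ hv hvs
  have hlaplc : Continuous (lapl Ψ) := by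
    have h (w : ℂ) : Continuous fun z => fderiv ℝ (fun z => fderiv ℝ Ψ z w) z w :=
      (((hΨ.fderiv_right (m := 1) (by norm_num)).clm_apply contDiff_const).continuous_fderiv
        one_ne_zero).clm_apply continuous_const
    exact (h 1).add (h I)
  have hv2c : Continuous fun z => ‖v z‖ ^ 2 := hv.continuous.norm.pow 2
  have hv2s : HasCompactSupport fun z => ‖v z‖ ^ 2 :=
    hvs.comp_left (g := fun w : ℂ => ‖w‖ ^ 2) (by simp)
  have iv := hv2c.integrable_of_hasCompactSupport (μ := volume) hv2s
  have ilv : Integrable fun z => lapl Ψ z * ‖v z‖ ^ 2 :=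
    (hlaplc.mul hv2c).integrable_of_hasCompactSupport hv2s.mul_left
  have hlower : s * (2 * a) * ∫ z, ‖v z‖ ^ 2 ≤ ∫ z, lapl Ψ z * ‖v z‖ ^ 2 := by
    rw [← integral_const_mul]
    refine integral_mono (iv.const_mul _) ilv fun z => ?_
    refine mul_le_mul_of_nonneg_right ?_ (sq_nonneg _)
    rw [hΨdef, lapl_const_mul_add_const_mul hφ hη]
    exact mul_le_mul_of_nonneg_left (hl z) hs
  have hvU : Real.exp (s * t) ^ 2 * ∫ z in U, ‖u z‖ ^ 2 ≤ ∫ z, ‖v z‖ ^ 2 := by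
    rw [← integral_const_mul]
    calc ∫ z in U, Real.exp (s * t) ^ 2 * ‖u z‖ ^ 2 = ∫ z in U, ‖v z‖ ^ 2 := by
          refine setIntegral_congr_fun hU fun z hz => ?_
          simp only [hvdef, hηU z hz, hχU z hz, norm_smul, mul_one, one_mul, mul_pow,
            Real.norm_eq_abs, Real.abs_exp]
      _ ≤ ∫ z, ‖v z‖ ^ 2 :=
          setIntegral_le_integral iv (Filter.Eventually.of_forall fun z => sq_nonneg _)
  have hDc : Continuous fun z => -wirtingerDz u z + (s : ℂ) * wirtingerDzR φ z * u z := by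
    have h1 (w : ℂ) : Continuous fun z => fderiv ℝ u z w :=
      (hu.continuous_fderiv one_ne_zero).clm_apply continuous_const
    have h2 (w : ℂ) : Continuous fun z => fderiv ℝ φ z w :=
      (hφ.continuous_fderiv two_ne_zero).clm_apply continuous_const
    have h3 := h1 1
    have h4 := h1 I
    have h5 := h2 1
    have h6 := h2 I
    have h7 := hu.continuous
    unfold wirtingerDz wirtingerDzR
    fun_prop
  have ion {f : ℂ → ℂ} (hf : Continuous f) : IntegrableOn (fun z => ‖f z‖ ^ 2) U' :=
    ((hf.norm.pow 2).continuousOn.integrableOn_compact hU'bdd.isCompact_closure).mono_set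
      subset_closure
  have iD := (ion hDc).const_mul (2 * Real.exp (s * t) ^ 2)
  have iu := (ion hu.continuous).const_mul (2 * M ^ 2)
  have hpt (z : ℂ) : ‖-wirtingerDz v z + wirtingerDzR Ψ z * v z‖ ^ 2 ≤ U'.indicator (fun z =>
      2 * Real.exp (s * t) ^ 2 * ‖-wirtingerDz u z + (s : ℂ) * wirtingerDzR φ z * u z‖ ^ 2 +
        2 * M ^ 2 * ‖u z‖ ^ 2) z := by
    rw [hvdef, hΨdef, adjoint_cutoff_mul_exp (hφ.differentiable two_ne_zero)
      (hη.differentiable two_ne_zero) (hχ.differentiable one_ne_zero)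
      (hu.differentiable one_ne_zero)]
    by_cases hz : z ∈ U'
    · rw [Set.indicator_of_mem hz]
      set D := -wirtingerDz u z + (s : ℂ) * wirtingerDzR φ z * u z
      have hexp : Real.exp (s * (t * η z)) ≤ Real.exp (s * t) :=
        Real.exp_le_exp.2 (mul_le_mul_of_nonneg_left (mul_le_of_le_one_right ht (hη1 z)) hs)
      have hfst : ‖(Real.exp (s * (t * η z)) : ℂ) * (χ z * D)‖ ≤ Real.exp (s * t) * ‖D‖ := by
        rw [norm_mul, norm_mul, norm_real, norm_real, Real.norm_eq_abs, Real.abs_exp]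
        refine mul_le_mul hexp (mul_le_of_le_one_left (norm_nonneg _) (hχ1 z)) (by positivity)
          (Real.exp_nonneg _)
      have hsnd : ‖(Real.exp (s * (t * η z)) : ℂ) * (wirtingerDzR χ z * u z)‖ ≤ M * ‖u z‖ := by
        have hW := (norm_wirtingerDzR_le χ z).trans (hM z)
        by_cases h0 : η z = 0
        · simpa [h0] using mul_le_mul_of_nonneg_right hW (norm_nonneg (u z))
        · have hM0 : 0 ≤ M := (norm_nonneg _).trans (hM z)
          have : wirtingerDzR χ z = 0 := by simp [wirtingerDzR, hχη z h0]
          simp only [this, zero_mul, mul_zero, norm_zero]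
          positivity
      have htri := norm_sub_le ((Real.exp (s * (t * η z)) : ℂ) * (χ z * D))
        ((Real.exp (s * (t * η z)) : ℂ) * (wirtingerDzR χ z * u z))
      rw [← mul_sub] at htri
      calc _ ≤ (Real.exp (s * t) * ‖D‖ + M * ‖u z‖) ^ 2 :=
            pow_le_pow_left₀ (norm_nonneg _) (htri.trans (add_le_add hfst hsnd)) 2
        _ ≤ _ := by nlinarith [sq_nonneg (Real.exp (s * t) * ‖D‖ - M * ‖u z‖)]
    · have hz' : z ∉ tsupport χ := fun h => hz (hχU' h)
      have h0 : fderiv ℝ χ z = 0 := image_eq_zero_of_notMem_tsupport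
        fun h => hz' (tsupport_fderiv_subset ℝ h)
      rw [Set.indicator_of_notMem hz]
      simp [wirtingerDzR, h0, image_eq_zero_of_notMem_tsupport hz']
  have hupper : ∫ z, ‖-wirtingerDz v z + wirtingerDzR Ψ z * v z‖ ^ 2 ≤
      2 * Real.exp (s * t) ^ 2 *
          (∫ z in U', ‖-wirtingerDz u z + (s : ℂ) * wirtingerDzR φ z * u z‖ ^ 2) +
        2 * M ^ 2 * ∫ z in U', ‖u z‖ ^ 2 := by
    rw [← integral_const_mul, ← integral_const_mul, ← integral_add iD iu,
      ← integral_indicator hU']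
    exact integral_mono_of_nonneg (Filter.Eventually.of_forall fun z => sq_nonneg _)
      ((integrable_indicator_iff hU').2 (iD.add iu)) (Filter.Eventually.of_forall hpt)
  have := mul_le_mul_of_nonneg_left hvU (mul_nonneg hs ha)
  linarith

/-- Exponential localization: `u` is recovered from `D̄_λ* u` on a slightly larger set,
up to an error exponentially small in `λ`. -/
theorem exponential_localization (U U' : Set ℂ)
    (hUopen : IsOpen U) (hU'open : IsOpen U')
    (hUbdd : Bornology.IsBounded U) (hU'bdd : Bornology.IsBounded U')
    (hclos : closure U ⊆ U')
    (φ : ℂ → ℝ) (hφ : ContDiff ℝ (⊤ : ℕ∞) φ) (a : ℝ) (ha : 0 < a)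
    (hHess : ∀ z : ℂ, a ≤ lapl φ z / 4) :
    ∃ C : ℝ, ∃ c > (0 : ℝ), ∃ Λ : ℝ, ∀ lam : ℝ, Λ ≤ lam →
      ∀ u : ℂ → ℂ, ContDiff ℝ 1 u →
        Real.sqrt (∫ z in U, ‖u z‖ ^ 2) ≤
          C * Real.sqrt (∫ z in U',
              ‖-wirtingerDz u z + (lam : ℂ) * wirtingerDzR φ z * u z‖ ^ 2) +
            C * Real.exp (-c * lam) * Real.sqrt (∫ z in U', ‖u z‖ ^ 2) := by
  obtain ⟨η, hη, hηs, hηU', hη01, hη1⟩ := exists_contDiff_bump_of_isCompact_subset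
    hUbdd.isCompact_closure hU'open hclos
  obtain ⟨χ, hχ, hχs, hχU', hχ01, hχ1⟩ := exists_contDiff_bump_of_isCompact_subset hηs.isCompact
    hU'open hηU'
  have htwo : (2 : WithTop ℕ∞) ≤ ((⊤ : ℕ∞) : WithTop ℕ∞) := WithTop.coe_le_coe.2 le_top
  have hone : (1 : WithTop ℕ∞) ≤ ((⊤ : ℕ∞) : WithTop ℕ∞) := WithTop.coe_le_coe.2 le_top
  have hη2 : ContDiff ℝ 2 η := hη.of_le htwo
  have hχC1 : ContDiff ℝ 1 χ := hχ.of_le hone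
  have hlapl (w : ℂ) : ∃ K, ∀ z, ‖fderiv ℝ (fun z => fderiv ℝ η z w) z w‖ ≤ K :=
    ((((hη2.fderiv_right (m := 1) (by norm_num)).clm_apply contDiff_const).continuous_fderiv
      one_ne_zero).clm_apply continuous_const).bounded_above_of_compact_support
      ((hηs.fderiv_apply ℝ w).fderiv_apply ℝ w)
  obtain ⟨K₁, hK₁⟩ := hlapl 1
  obtain ⟨K₂, hK₂⟩ := hlapl I
  obtain ⟨M, hM⟩ := (hχC1.continuous_fderiv one_ne_zero).bounded_above_of_compact_support
    (hχs.fderiv ℝ)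
  have hK₁0 : 0 ≤ K₁ := (norm_nonneg _).trans (hK₁ 0)
  have hK₂0 : 0 ≤ K₂ := (norm_nonneg _).trans (hK₂ 0)
  have hM0 : 0 ≤ M := (norm_nonneg _).trans (hM 0)
  have hKpos : 0 < K₁ + K₂ + 1 := by positivity
  set t := 2 * a / (K₁ + K₂ + 1) with ht_def
  have ht : 0 < t := by positivity
  have htK : t * (K₁ + K₂ + 1) = 2 * a := by rw [ht_def]; field_simp
  have hηU (z : ℂ) (hz : z ∈ U) : η z = 1 := hη1 z (subset_closure hz)
  have hχη (z : ℂ) (hz : η z ≠ 0) : χ z = 1 := hχ1 z (subset_tsupport η hz)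
  refine ⟨2 * (1 + M), t, ht, 1 / a, fun s hs u hu => ?_⟩
  have hsa : 1 ≤ s * a := (div_le_iff₀ ha).1 hs
  have hs0 : 0 ≤ s := (by positivity : 0 ≤ 1 / a).trans hs
  have key := integral_norm_sq_weighted_le hUopen.measurableSet hU'open.measurableSet hU'bdd
    (hφ.of_le htwo) hη2 hχC1 hχs hχU' (fun z => (hη01 z).2)
    (fun z => abs_le.2 ⟨by linarith [(hχ01 z).1], (hχ01 z).2⟩) hηU
    (fun z hz => hχη z (by simp [hηU z hz]))
    (fun z hz => by
      have hev : χ =ᶠ[nhds z] fun _ => 1 :=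
        (hη.continuous.continuousAt.eventually_ne hz).mono fun w hw => hχη w hw
      rw [hev.fderiv_eq, fderiv_fun_const, Pi.zero_apply])
    hM ha.le ht.le hs0 (fun z => by
      have h1 := (abs_le.1 (hK₁ z)).1
      have h2 := (abs_le.1 (hK₂ z)).1
      have h3 : -(K₁ + K₂ + 1) ≤ lapl η z := by unfold lapl; linarith
      have h4 := mul_le_mul_of_nonneg_left h3 ht.le
      have h5 := hHess z
      linarith) hu
  have hX : 0 ≤ ∫ z in U, ‖u z‖ ^ 2 := integral_nonneg fun z => sq_nonneg _
  have hY : 0 ≤ ∫ z in U', ‖-wirtingerDz u z + (s : ℂ) * wirtingerDzR φ z * u z‖ ^ 2 :=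
    integral_nonneg fun z => sq_nonneg _
  have hZ : 0 ≤ ∫ z in U', ‖u z‖ ^ 2 := integral_nonneg fun z => sq_nonneg _
  generalize (∫ z in U, ‖u z‖ ^ 2) = X at *
  generalize (∫ z in U', ‖-wirtingerDz u z + (s : ℂ) * wirtingerDzR φ z * u z‖ ^ 2) = Y at *
  generalize (∫ z in U', ‖u z‖ ^ 2) = Z at *
  have hEF : Real.exp (-t * s) * Real.exp (s * t) = 1 := by
    rw [← Real.exp_add]; simp [mul_comm]
  have hF := Real.exp_pos (-t * s)
  generalize Real.exp (s * t) = e at *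
  generalize Real.exp (-t * s) = f at *
  have hEF2 : f ^ 2 * e ^ 2 = 1 := by rw [← mul_pow, hEF, one_pow]
  have hXle : X ≤ 2 * Y + 2 * M ^ 2 * (f ^ 2 * Z) := by
    have h1 := mul_le_mul_of_nonneg_left key (sq_nonneg f)
    have h2 : f ^ 2 * (s * a * e ^ 2 * X) = s * a * X := by
      linear_combination (s * a * X) * hEF2
    have h3 : f ^ 2 * (2 * e ^ 2 * Y + 2 * M ^ 2 * Z) = 2 * Y + 2 * M ^ 2 * (f ^ 2 * Z) := by
      linear_combination (2 * Y) * hEF2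
    rw [h2, h3] at h1
    nlinarith
  refine Real.sqrt_le_iff.2 ⟨by positivity, hXle.trans ?_⟩
  obtain ⟨y, hy, rfl⟩ : ∃ y, 0 ≤ y ∧ Y = y ^ 2 :=
    ⟨√Y, Real.sqrt_nonneg _, (Real.sq_sqrt hY).symm⟩
  obtain ⟨w, hw, rfl⟩ : ∃ w, 0 ≤ w ∧ Z = w ^ 2 :=
    ⟨√Z, Real.sqrt_nonneg _, (Real.sq_sqrt hZ).symm⟩
  rw [Real.sqrt_sq hy, Real.sqrt_sq hw, ← mul_pow]
  have hfw : 0 ≤ f * w := by positivity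
  have h1 : 0 ≤ M * y ^ 2 := by positivity
  have h2 : 0 ≤ M * (f * w) ^ 2 := by positivity
  have h3 : 0 ≤ (1 + M) ^ 2 * (y * (f * w)) := by positivity
  have h4 : 0 ≤ (M * y) ^ 2 := sq_nonneg _
  have h5 : 0 ≤ (M * (f * w)) ^ 2 := sq_nonneg _
  rw [mul_assoc _ f w]
  generalize f * w = g at *
  nlinarith [sq_nonneg y, sq_nonneg g]
end
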